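/- Let ξ(t), t ∈ [0,1], be a random process that is continuous with probability one, i.e. a Borel random variable ξ with values in the Banach space C[0,1] of continuous real functions on [0,1] with the uniform norm. Then there exists a compact injective bounded linear operator U : C[0,1] → C[0,1], depending only on the distribution of ξ, such that ξ belongs to the range of U with probability one. -/

import Mathlib

open MeasureTheory

theorem aux_abstract {E : Type*} [NormedAddCommGroup E] [NormedSpace ℝ E] [CompleteSpace E]
    (T : ℕ → E →L[ℝ] E) (hT0 : T 0 = 0)
    (h1 : ∀ i j, i ≤ j → ∀ f, T i (T j f) = T i f)
    (h2 : ∀ i j, i ≤ j → ∀ f, T j (T i f) = T i f)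
    (hn : ∀ j, ‖T j‖ ≤ 1) (hc : ∀ j, IsCompactOperator (T j))
    (hl : ∀ f, Filter.Tendsto (fun j => T j f) Filter.atTop (nhds f)) :
    ∃ U : E →L[ℝ] E, IsCompactOperator U ∧ Function.Injective U ∧
      ∀ f, (∀ᶠ j in Filter.atTop, ‖T j f - f‖ ≤ (1/4 : ℝ)^j) → ∃ y, f = U y := by
  set D : ℕ → E →L[ℝ] E := fun j => T (j+1) - T j with hD
  have hDn : ∀ j, ‖D j‖ ≤ 2 := fun j => by
    have := norm_sub_le (T (j+1)) (T j)
    have := hn j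
    have := hn (j+1)
    simp only [hD]; linarith
  have hDD : ∀ i j f, D i (D j f) = if i = j then D j f else 0 := by
    intro i j f
    rcases lt_trichotomy i j with h | h | h
    · simp [hD, h.ne, h1 (i+1) (j+1) (by omega), h1 (i+1) j (by omega), h1 i j (by omega),
        h1 i (j+1) (by omega)]
    · subst h
      simp [hD, h1 i (i+1) (by omega), h1 i i le_rfl, h1 (i+1) (i+1) le_rfl,
        h2 i (i+1) (by omega)]
    · simp [hD, h.ne', h2 (j+1) (i+1) (by omega), h2 (j+1) i (by omega), h2 j i (by omega),
        h2 j (i+1) (by omega)]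
  have hS : Summable (fun j => ((1/2 : ℝ)^j) • D j) := by
    refine Summable.of_norm_bounded (g := fun j => (1/2 : ℝ)^j * 2)
      (summable_geometric_two.mul_right 2) fun j => ?_
    rw [norm_smul, Real.norm_of_nonneg (by positivity)]
    exact mul_le_mul_of_nonneg_left (hDn j) (by positivity)
  set U : E →L[ℝ] E := ∑' j, ((1/2 : ℝ)^j) • D j with hU
  have hUs : ∀ x, HasSum (fun j => ((1/2 : ℝ)^j) • D j x) (U x) := fun x => by
    have := hS.hasSum.mapL (ContinuousLinearMap.apply ℝ E x)
    exact this
  have hUD : ∀ j f, U (D j f) = ((1/2 : ℝ)^j) • D j f := fun j f => by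
    refine (hUs (D j f)).unique ?_
    have := hasSum_single (f := fun i => ((1/2 : ℝ)^i) • D i (D j f)) j
      (fun i hi => by simp [hDD, hi])
    simpa [hDD] using this
  have hDU : ∀ i x, D i (U x) = ((1/2 : ℝ)^i) • D i x := fun i x => by
    refine ((hUs x).mapL (D i)).unique ?_
    have := hasSum_single (f := fun j => D i (((1/2 : ℝ)^j) • D j x)) i
      (fun j hj => by simp [hDD, hj.symm])
    simpa [hDD] using this
  have htel : ∀ n f, ∑ j ∈ Finset.range n, D j f = T n f := fun n f => by
    have := Finset.sum_range_sub (fun j => T j f) n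
    simpa [hD, hT0] using this
  refine ⟨U, ?_, ?_, ?_⟩
  · refine isCompactOperator_of_tendsto (l := Filter.atTop) hS.hasSum.tendsto_sum_nat
      (Filter.Eventually.of_forall fun n => ?_)
    have : ∀ n, ∑ j ∈ Finset.range n, ((1/2 : ℝ)^j) • D j ∈
        compactOperator (RingHom.id ℝ) E E := fun n =>
      Submodule.sum_mem _ fun j _ => Submodule.smul_mem _ _ ((hc (j+1)).sub (hc j))
    exact this n
  · rw [injective_iff_map_eq_zero]
    intro x hx
    have h0 : ∀ i, D i x = 0 := fun i => by
      have := hDU i x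
      rw [hx, map_zero] at this
      exact (smul_eq_zero.1 this.symm).resolve_left (by positivity)
    have : ∀ n, T n x = 0 := fun n => by rw [← htel]; simp [h0]
    refine tendsto_nhds_unique (hl x) ?_
    simp [this]
  · intro f hf
    have hS2 : Summable (fun j => ((2 : ℝ)^j) • D j f) := by
      refine Summable.of_norm_bounded_eventually_nat (g := fun j => (1/2 : ℝ)^j * 2)
        (summable_geometric_two.mul_right 2) ?_
      filter_upwards [hf, (Filter.tendsto_add_atTop_nat 1).eventually hf] with j a b
      rw [norm_smul, Real.norm_of_nonneg (by positivity)]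
      have e : D j f = (T (j+1) f - f) - (T j f - f) := by simp [hD]
      have h3 : ‖D j f‖ ≤ (1/4 : ℝ)^j * 2 := by
        rw [e]
        have := norm_sub_le (T (j+1) f - f) (T j f - f)
        have : (1/4 : ℝ)^(j+1) ≤ (1/4 : ℝ)^j := pow_le_pow_of_le_one (by norm_num) (by norm_num) (by omega)
        linarith
      calc (2:ℝ)^j * ‖D j f‖ ≤ 2^j * ((1/4 : ℝ)^j * 2) := by gcongr
        _ = (1/2 : ℝ)^j * 2 := by rw [← mul_assoc, ← mul_pow]; norm_num
    refine ⟨∑' j, ((2 : ℝ)^j) • D j f, ?_⟩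
    have h4 := (hS2.hasSum.mapL U).tendsto_sum_nat
    refine tendsto_nhds_unique (hl f) ?_
    convert h4 using 2 with n
    rw [← htel]
    refine Finset.sum_congr rfl fun j _ => ?_
    rw [map_smul, hUD, smul_smul, ← mul_pow]
    norm_num

/-- the hat function -/
noncomputable def auxHat (n k : ℕ) : C(unitInterval, ℝ) :=
  ⟨fun t => max 0 (1 - |2^n * (t : ℝ) - k|), by fun_prop⟩

/-- dyadic nodes -/
noncomputable def auxNode (n k : ℕ) : unitInterval :=
  Set.projIcc (0:ℝ) 1 zero_le_one (k / 2^n)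

/-- piecewise linear interpolation -/
noncomputable def auxL (n : ℕ) : C(unitInterval, ℝ) →L[ℝ] C(unitInterval, ℝ) :=
  ∑ k ∈ Finset.range (2^n+1), (ContinuousMap.evalCLM ℝ (auxNode n k)).smulRight (auxHat n k)

theorem auxL_apply (n : ℕ) (f : C(unitInterval, ℝ)) (t : unitInterval) :
    auxL n f t = ∑ k ∈ Finset.range (2^n+1), f (auxNode n k) * max 0 (1 - |2^n * (t : ℝ) - k|) := by
  simp [auxL, ContinuousMap.sum_apply, auxHat]

theorem auxNode_coe (n k : ℕ) (hk : k ≤ 2^n) : (auxNode n k : ℝ) = k / 2^n := by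
  have : (k:ℝ) ≤ 2^n := by exact_mod_cast hk
  rw [auxNode, Set.projIcc_of_mem zero_le_one ⟨by positivity, by rw [div_le_one (by positivity)]; exact this⟩]

theorem auxL_local (n : ℕ) (f : C(unitInterval, ℝ)) (t : unitInterval) (k : ℕ) (hk : k < 2^n)
    (s : ℝ) (hs0 : 0 ≤ s) (hs1 : s ≤ 1) (ht : 2^n * (t:ℝ) = k + s) :
    auxL n f t = (1 - s) * f (auxNode n k) + s * f (auxNode n (k+1)) := by
  rw [auxL_apply, ht]
  have : ∀ j : ℕ, f (auxNode n j) * max 0 (1 - |(k:ℝ) + s - j|) =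
      (if j = k then (1 - s) * f (auxNode n k) else 0) +
      (if j = k+1 then s * f (auxNode n (k+1)) else 0) := by
    intro j
    rcases lt_trichotomy j k with h | h | h
    · have h' : (j:ℝ) + 1 ≤ k := by exact_mod_cast h
      rw [if_neg (by omega), if_neg (by omega), max_eq_left]
      · simp
      · rw [abs_of_nonneg (by linarith)]; linarith
    · subst h
      rw [if_pos rfl, if_neg (by omega), add_sub_cancel_left, abs_of_nonneg hs0, max_eq_right (by linarith)]
      ring
    · rcases eq_or_ne j (k+1) with h3 | h3
      · subst h3
        rw [if_neg (by omega), if_pos rfl]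
        push_cast
        rw [abs_of_nonpos (by linarith), max_eq_right (by linarith)]
        ring
      · have h' : (k:ℝ) + 2 ≤ j := by exact_mod_cast (show k + 2 ≤ j by omega)
        rw [if_neg (by omega), if_neg (by omega), max_eq_left]
        · simp
        · rw [abs_of_nonpos (by linarith)]; linarith
  rw [Finset.sum_congr rfl fun j _ => this j, Finset.sum_add_distrib, Finset.sum_ite_eq',
    Finset.sum_ite_eq', if_pos (by simp; omega), if_pos (by simp; omega)]

theorem aux_exists (n : ℕ) (t : unitInterval) :
    ∃ k : ℕ, k < 2^n ∧ ∃ s : ℝ, 0 ≤ s ∧ s ≤ 1 ∧ 2^n * (t:ℝ) = k + s := by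
  have t0 := t.2.1
  have t1 := t.2.2
  by_cases h : (t:ℝ) = 1
  · refine ⟨2^n - 1, Nat.sub_lt (by positivity) one_pos, 1, by norm_num, le_rfl, ?_⟩
    rw [h, Nat.cast_sub Nat.one_le_two_pow]; simp
  · have ht : (t:ℝ) < 1 := lt_of_le_of_ne t1 h
    have hp : (0:ℝ) < 2^n := by positivity
    have a := Nat.floor_le (show 0 ≤ 2^n * (t:ℝ) by positivity)
    have b := Nat.lt_floor_add_one (2^n * (t:ℝ))
    refine ⟨⌊2^n * (t:ℝ)⌋₊, ?_, 2^n * (t:ℝ) - ⌊2^n * (t:ℝ)⌋₊, by linarith, by linarith, by ring⟩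
    rw [Nat.floor_lt (by positivity)]
    push_cast
    nlinarith

theorem auxL_node (n : ℕ) (f : C(unitInterval, ℝ)) (k : ℕ) (hk : k ≤ 2^n) :
    auxL n f (auxNode n k) = f (auxNode n k) := by
  have hc := auxNode_coe n k hk
  have hp : (2:ℝ)^n ≠ 0 := by positivity
  rcases hk.lt_or_eq with h | h
  · rw [auxL_local n f _ k h 0 le_rfl zero_le_one (by rw [hc]; field_simp; ring)]; ring
  · obtain ⟨m, rfl⟩ : ∃ m, k = m + 1 := ⟨k - 1, by
      have : 0 < 2^n := by positivity
      omega⟩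
    rw [auxL_local n f _ m (by omega) 1 zero_le_one le_rfl (by rw [hc]; field_simp; push_cast; ring)]
    ring

theorem auxNode_refine (n d k : ℕ) : auxNode n k = auxNode (n+d) (2^d * k) := by
  rw [auxNode, auxNode]
  congr 1
  push_cast
  rw [pow_add]
  field_simp

/-- coarse after fine -/
theorem auxL_coarse (n m : ℕ) (h : n ≤ m) (f : C(unitInterval, ℝ)) :
    auxL n (auxL m f) = auxL n f := by
  obtain ⟨d, rfl⟩ := Nat.exists_eq_add_of_le h
  ext t
  rw [auxL_apply, auxL_apply]
  refine Finset.sum_congr rfl fun k hk => ?_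
  have hk' : k ≤ 2^n := by simp at hk; omega
  rw [auxNode_refine n d k, auxL_node]
  rw [pow_add, mul_comm]
  exact Nat.mul_le_mul_right _ hk'

theorem auxL_fine_of (m : ℕ) (g : C(unitInterval, ℝ))
    (hg : ∀ k : ℕ, k < 2^m → ∀ s : ℝ, 0 ≤ s → s ≤ 1 → ∀ t : unitInterval, 2^m * (t:ℝ) = k + s →
      g t = (1 - s) * g (auxNode m k) + s * g (auxNode m (k+1))) : auxL m g = g := by
  ext t
  obtain ⟨k, hk, s, h0, h1, ht⟩ := aux_exists m t
  rw [auxL_local m g t k hk s h0 h1 ht, hg k hk s h0 h1 t ht]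

theorem auxL_fine (n m : ℕ) (h : n ≤ m) (f : C(unitInterval, ℝ)) :
    auxL m (auxL n f) = auxL n f := by
  obtain ⟨d, rfl⟩ := Nat.exists_eq_add_of_le h
  refine auxL_fine_of _ _ fun k hk s h0 h1 t ht => ?_
  -- coarse cell
  set q := k / 2^d with hq
  set r := k % 2^d with hr
  have hkqr : 2^d * q + r = k := Nat.div_add_mod k (2^d)
  have hrlt : r < 2^d := Nat.mod_lt _ (by positivity)
  have hqlt : q < 2^n := by
    rw [hq, Nat.div_lt_iff_lt_mul (by positivity), ← pow_add]; exact hk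
  have hD : (0:ℝ) < 2^d := by positivity
  have hN : (0:ℝ) < 2^n := by positivity
  have hkR : (2:ℝ)^d * q + r = k := by exact_mod_cast hkqr
  have hrR : (r:ℝ) + 1 ≤ 2^d := by exact_mod_cast hrlt
  have key : ∀ (u : ℝ) (x : unitInterval), 0 ≤ u → u ≤ 1 → 2^(n+d) * (x:ℝ) = k + u →
      auxL n f x = (1 - (r + u)/2^d) * f (auxNode n q) + (r + u)/2^d * f (auxNode n (q+1)) := by
    intro u x hu0 hu1 hx
    refine auxL_local n f x q hqlt ((r+u)/2^d) (by positivity) ?_ ?_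
    · rw [div_le_one hD]; linarith
    · rw [pow_add] at hx
      field_simp
      linarith
  have c1 := auxNode_coe (n+d) k hk.le
  have c2 := auxNode_coe (n+d) (k+1) hk
  rw [key s t h0 h1 ht, key 0 _ le_rfl zero_le_one (by rw [c1]; field_simp; ring),
    key 1 _ zero_le_one le_rfl (by rw [c2]; field_simp; push_cast; ring)]
  field_simp
  ring

theorem auxL_norm (n : ℕ) : ‖auxL n‖ ≤ 1 := by
  refine ContinuousLinearMap.opNorm_le_bound _ zero_le_one fun f => ?_
  rw [one_mul, ContinuousMap.norm_le _ (norm_nonneg _)]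
  intro t
  obtain ⟨k, hk, s, h0, h1, ht⟩ := aux_exists n t
  rw [auxL_local n f t k hk s h0 h1 ht]
  have a := f.norm_coe_le_norm (auxNode n k)
  have b := f.norm_coe_le_norm (auxNode n (k+1))
  rw [Real.norm_eq_abs, abs_le] at *
  constructor <;> nlinarith

theorem auxL_compact (n : ℕ) : IsCompactOperator (auxL n) := by
  have : auxL n ∈ compactOperator (RingHom.id ℝ) C(unitInterval, ℝ) C(unitInterval, ℝ) := by
    refine Submodule.sum_mem _ fun k _ => ?_
    have h : IsCompactOperator (ContinuousMap.evalCLM ℝ (auxNode n k) : C(unitInterval, ℝ) →L[ℝ] ℝ) :=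
      isCompactOperator_of_locallyCompactSpace_dom _
    exact h.clm_comp ((ContinuousLinearMap.id ℝ ℝ).smulRight (auxHat n k))
  exact this

theorem auxL_tendsto (f : C(unitInterval, ℝ)) :
    Filter.Tendsto (fun n => auxL n f) Filter.atTop (nhds f) := by
  rw [Metric.tendsto_atTop]
  intro ε hε
  have huc := CompactSpace.uniformContinuous_of_continuous f.continuous
  obtain ⟨δ, hδ, hf⟩ := Metric.uniformContinuous_iff.1 huc (ε/2) (by positivity)
  obtain ⟨N, hN⟩ := exists_pow_lt_of_lt_one hδ (show (1/2:ℝ) < 1 by norm_num)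
  refine ⟨N, fun n hn => ?_⟩
  have hn' : (1/2:ℝ)^n < δ :=
    lt_of_le_of_lt (pow_le_pow_of_le_one (by norm_num) (by norm_num) hn) hN
  have hp : (0:ℝ) < 2^n := by positivity
  rw [one_div, inv_pow] at hn'
  have hn2 : 1 < δ * 2^n := by rwa [inv_lt_iff_one_lt_mul₀ hp] at hn'
  refine lt_of_le_of_lt ((ContinuousMap.dist_le (by positivity : 0 ≤ ε/2)).2 fun t => ?_)
    (half_lt_self hε)
  obtain ⟨k, hk, s, h0, h1, ht⟩ := aux_exists n t
  rw [auxL_local n f t k hk s h0 h1 ht]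
  have htv : (t:ℝ) = (k + s)/2^n := by field_simp; linarith
  have a := hf (a := auxNode n k) (b := t) (by
    rw [Subtype.dist_eq, auxNode_coe n k hk.le, htv, Real.dist_eq, ← sub_div, abs_div,
      abs_of_pos hp, div_lt_iff₀ hp, abs_lt]
    constructor <;> linarith)
  have b := hf (a := auxNode n (k+1)) (b := t) (by
    rw [Subtype.dist_eq, auxNode_coe n (k+1) hk, htv, Real.dist_eq, ← sub_div, abs_div,
      abs_of_pos hp, div_lt_iff₀ hp, abs_lt]
    push_cast
    constructor <;> linarith)
  rw [Real.dist_eq, abs_lt] at a b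
  rw [Real.dist_eq, abs_le]
  constructor <;> nlinarith


/-- Every random variable `ξ` with values in `C[0,1]` (continuous functions on `[0,1]` with
the uniform norm) lies, with probability one, in the range of some compact injective bounded
linear operator `U : C[0,1] → C[0,1]`. -/
theorem exists_compact_injective_operator_range_ae_continuousMap
    [MeasurableSpace C(unitInterval, ℝ)] [BorelSpace C(unitInterval, ℝ)]
    {Ω : Type*} [MeasurableSpace Ω] (P : Measure Ω) [IsProbabilityMeasure P]
    (ξ : Ω → C(unitInterval, ℝ)) (hξ : Measurable ξ) :
    ∃ U : C(unitInterval, ℝ) →L[ℝ] C(unitInterval, ℝ),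
      IsCompactOperator U ∧ Function.Injective U ∧
      ∀ᵐ ω ∂P, ∃ y : C(unitInterval, ℝ), ξ ω = U y := by
  classical
  have hm : ∀ n, Measurable (fun ω => ‖auxL n (ξ ω) - ξ ω‖) := fun n => by
    have : Continuous (fun f : C(unitInterval, ℝ) => ‖auxL n f - f‖) := by fun_prop
    exact this.measurable.comp hξ
  have hTM : TendstoInMeasure P (fun n ω => ‖auxL n (ξ ω) - ξ ω‖) Filter.atTop (fun _ => (0:ℝ)) := by
    refine tendstoInMeasure_of_tendsto_ae (fun n => (hm n).aestronglyMeasurable)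
      (Filter.Eventually.of_forall fun ω => ?_)
    exact tendsto_iff_norm_sub_tendsto_zero.1 (auxL_tendsto (ξ ω))
  have hev : ∀ j : ℕ, ∀ᶠ n in Filter.atTop,
      P {ω | ENNReal.ofReal ((1/4:ℝ)^j) ≤ edist (‖auxL n (ξ ω) - ξ ω‖) (0:ℝ)} < (1/2 : ENNReal)^j :=
    fun j => (hTM _ (by simp)).eventually_lt_const (by
      apply ENNReal.pow_pos; simp)
  obtain ⟨φ, hφ, hφP⟩ := Filter.extraction_forall_of_eventually hev
  have hBC := ae_eventually_notMem (μ := P)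
    (s := fun j => {ω | ENNReal.ofReal ((1/4:ℝ)^j) ≤ edist (‖auxL (φ j) (ξ ω) - ξ ω‖) (0:ℝ)}) (by
      refine ne_top_of_le_ne_top ?_ (ENNReal.tsum_le_tsum fun j => (hφP j).le)
      rw [ENNReal.tsum_geometric]
      simp)
  set T : ℕ → C(unitInterval, ℝ) →L[ℝ] C(unitInterval, ℝ) :=
    fun j => if j = 0 then 0 else auxL (φ j) with hT
  have hTev : ∀ j, 1 ≤ j → T j = auxL (φ j) := fun j hj => if_neg (by omega)
  have hT0 : T 0 = 0 := if_pos rfl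
  obtain ⟨U, hU1, hU2, hU3⟩ := aux_abstract T hT0
    (by
      intro i j hij f
      rcases Nat.eq_zero_or_pos i with rfl | hi
      · simp [hT0]
      · rw [hTev i hi, hTev j (le_trans hi hij)]
        exact auxL_coarse _ _ (hφ.monotone hij) f)
    (by
      intro i j hij f
      rcases Nat.eq_zero_or_pos i with rfl | hi
      · simp [hT0]
      · rw [hTev i hi, hTev j (le_trans hi hij)]
        exact auxL_fine _ _ (hφ.monotone hij) f)
    (by
      intro j
      rcases Nat.eq_zero_or_pos j with rfl | hi
      · simp [hT0]
      · rw [hTev j hi]; exact auxL_norm _)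
    (by
      intro j
      rcases Nat.eq_zero_or_pos j with rfl | hi
      · rw [hT0]; exact isCompactOperator_zero
      · rw [hTev j hi]; exact auxL_compact _)
    (by
      intro f
      refine ((auxL_tendsto f).comp hφ.tendsto_atTop).congr' ?_
      filter_upwards [Filter.eventually_ge_atTop 1] with j hj
      rw [hTev j hj]; rfl)
  refine ⟨U, hU1, hU2, ?_⟩
  filter_upwards [hBC] with ω hω
  refine hU3 (ξ ω) ?_
  filter_upwards [hω, Filter.eventually_ge_atTop 1] with j hj hj1
  rw [hTev j hj1]
  by_contra hcon
  refine hj ?_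
  change _ ≤ edist _ _
  rw [edist_dist, Real.dist_eq, sub_zero, abs_of_nonneg (norm_nonneg _)]
  exact ENNReal.ofReal_le_ofReal (not_le.1 hcon).le
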